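/- Let a, b, c ∈ A with ĉ · (S(a*))^ = (S(a*))^ (convolution of linear functionals on A). If d ∈ A satisfies d̂ = (ĉ)* · b̂ · â (convolution products, with ω*(x) = conj(ω(S(x)*))), then ε(d) = φ(S⁻¹(a) b). (Equivalently, ψ̂(ĉ* b̂ â) = φ(S⁻¹(a) b); this is the concrete form of Proposition 3.1(a), expressing that the functional Q(a) is given by the vector functional ω_{Λ(a),Λ(c)}.) -/

import Mathlib

open scoped TensorProduct ComplexOrder

noncomputable section

/-- Right slice map `(id ⊗ φ) : M ⊗ A → M`. -/
def rslice {A M : Type*} [AddCommGroup A] [Module ℂ A] [AddCommGroup M] [Module ℂ M]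
    (φ : A →ₗ[ℂ] ℂ) : M ⊗[ℂ] A →ₗ[ℂ] M :=
  (TensorProduct.rid ℂ M).toLinearMap ∘ₗ TensorProduct.map LinearMap.id φ

/-- Left slice map `(φ ⊗ id) : A ⊗ M → M`. -/
def lslice {A M : Type*} [AddCommGroup A] [Module ℂ A] [AddCommGroup M] [Module ℂ M]
    (φ : A →ₗ[ℂ] ℂ) : A ⊗[ℂ] M →ₗ[ℂ] M :=
  (TensorProduct.lid ℂ M).toLinearMap ∘ₗ TensorProduct.map φ LinearMap.id

/-- The pairing `(ω ⊗ η) : A ⊗ A → ℂ`. -/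
def pair {A : Type*} [AddCommGroup A] [Module ℂ A] (ω η : A →ₗ[ℂ] ℂ) :
    A ⊗[ℂ] A →ₗ[ℂ] ℂ :=
  LinearMap.mul' ℂ ℂ ∘ₗ TensorProduct.map ω η

/-- Convolution product of linear functionals: `ω₁·ω₂ = (ω₁ ⊗ ω₂) ∘ Δ`. -/
def conv {A : Type*} [Ring A] [Algebra ℂ A] (Δ : A →ₐ[ℂ] A ⊗[ℂ] A)
    (ω η : A →ₗ[ℂ] ℂ) : A →ₗ[ℂ] ℂ :=
  pair ω η ∘ₗ Δ.toLinearMap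

/-- The conjugate dual functional `x ↦ conj (ω (x*))`. -/
def conjdual {A : Type*} [Ring A] [Algebra ℂ A] [StarRing A] [StarModule ℂ A]
    (ω : A →ₗ[ℂ] ℂ) : A →ₗ[ℂ] ℂ where
  toFun x := starRingEnd ℂ (ω (star x))
  map_add' x y := by simp
  map_smul' c x := by simp [star_smul, smul_eq_mul, map_mul]

/-- A (unital) algebraic quantum group: a unital Hopf ∗-algebra over ℂ with a
positive faithful left Haar integral, together with the associated modular
data `ρ`, `δ`, `μ`. -/
structure AQG (A : Type*) [Ring A] [Algebra ℂ A] [StarRing A] [StarModule ℂ A] where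
  Δ : A →ₐ[ℂ] A ⊗[ℂ] A
  ε : A →ₐ[ℂ] ℂ
  S : A →ₗ[ℂ] A
  Sinv : A →ₗ[ℂ] A
  φ : A →ₗ[ℂ] ℂ
  ρ : A →ₗ[ℂ] A
  ρinv : A →ₗ[ℂ] A
  δ : A
  δinv : A
  μ : ℂ
  /-- `Δ` is a ∗-homomorphism (expressed by composing with functionals, since
  they separate points of `A ⊗ A`). -/
  Δ_star : ∀ (f g : A →ₗ[ℂ] ℂ) (a : A),
    pair f g (Δ (star a)) = starRingEnd ℂ (pair (conjdual f) (conjdual g) (Δ a))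
  ε_star : ∀ a, ε (star a) = starRingEnd ℂ (ε a)
  coassoc : ∀ a, TensorProduct.assoc ℂ A A A
      (TensorProduct.map Δ.toLinearMap LinearMap.id (Δ a)) =
      TensorProduct.map LinearMap.id Δ.toLinearMap (Δ a)
  counit_left : ∀ a, lslice ε.toLinearMap (Δ a) = a
  counit_right : ∀ a, rslice ε.toLinearMap (Δ a) = a
  S_leftinv : Function.LeftInverse Sinv S
  S_rightinv : Function.RightInverse Sinv S
  S_antimul : ∀ a b, S (a * b) = S b * S a
  S_one : S 1 = 1
  antipode_left : ∀ a, LinearMap.mul' ℂ A (TensorProduct.map S LinearMap.id (Δ a)) = ε a • 1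
  antipode_right : ∀ a, LinearMap.mul' ℂ A (TensorProduct.map LinearMap.id S (Δ a)) = ε a • 1
  S_star_S : ∀ a, S (star (S (star a))) = a
  /-- positivity of the Haar functional -/
  φ_pos : ∀ a, 0 ≤ φ (star a * a)
  φ_faithful : ∀ a, φ (star a * a) = 0 → a = 0
  /-- left invariance: `(id ⊗ φ)(Δ a) = φ(a)·1` -/
  φ_left_inv : ∀ a, rslice φ (Δ a) = φ a • (1 : A)
  /-- strong left invariance -/
  φ_strong : ∀ a b, rslice φ ((1 ⊗ₜ[ℂ] a) * Δ b) = S (rslice φ (Δ a * (1 ⊗ₜ[ℂ] b)))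
  ρ_mul : ∀ a b, ρ (a * b) = ρ a * ρ b
  ρ_leftinv : Function.LeftInverse ρinv ρ
  ρ_rightinv : Function.RightInverse ρinv ρ
  φ_ρ : ∀ a b, φ (a * b) = φ (b * ρ a)
  δ_star : star δ = δ
  δ_mul_δinv : δ * δinv = 1
  δinv_mul_δ : δinv * δ = 1
  Δ_δ : Δ δ = δ ⊗ₜ[ℂ] δ
  ε_δ : ε δ = 1
  S_δ : S δ = δinv
  μ_norm : ‖μ‖ = 1
  φ_S : ∀ a, φ (S a) = φ (a * δ)
  φ_δ : ∀ a, φ (a * δ) = μ * φ (δ * a)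

namespace AQG

variable {A : Type*} [Ring A] [Algebra ℂ A] [StarRing A] [StarModule ℂ A] (G : AQG A)

/-- `â : c ↦ φ(c a)`. -/
def hat (a : A) : A →ₗ[ℂ] ℂ := G.φ ∘ₗ LinearMap.mulRight ℂ a

/-- Involution on functionals: `ω*(x) = conj (ω (S(x)*))`. -/
def inv' (ω : A →ₗ[ℂ] ℂ) : A →ₗ[ℂ] ℂ := conjdual ω ∘ₗ G.S

end AQG


namespace AQG

variable {A : Type*} [Ring A] [Algebra ℂ A] [StarRing A] [StarModule ℂ A] (G : AQG A)

lemma hat_apply (a x : A) : G.hat a x = G.φ (x * a) := rfl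

lemma hat_injective : Function.Injective G.hat := by
  intro a b h
  have h₁ : G.φ (star (a - b) * (a - b)) = 0 := by
    have h₂ := LinearMap.congr_fun h (star (a - b))
    rw [hat_apply, hat_apply] at h₂
    rw [mul_sub, map_sub, h₂, sub_self]
  exact sub_eq_zero.mp (G.φ_faithful _ h₁)

lemma pair_hat (ω : A →ₗ[ℂ] ℂ) (a : A) (t : A ⊗[ℂ] A) :
    pair ω (G.hat a) t = ω (rslice G.φ (t * (1 ⊗ₜ[ℂ] a))) := by
  induction t with
  | zero => simp
  | tmul x y => simp [pair, rslice, hat_apply, mul_comm]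
  | add x y hx hy => rw [map_add, hx, hy, add_mul, map_add, map_add]

lemma map_rslice_one_tmul_mul (η : A →ₗ[ℂ] ℂ) (x : A) (t : A ⊗[ℂ] A) :
    η (rslice G.φ ((1 ⊗ₜ[ℂ] x) * t)) = G.φ (x * lslice η t) := by
  induction t with
  | zero => simp
  | tmul y z => simp [rslice, lslice, mul_comm]
  | add y z hy hz => rw [mul_add, map_add, map_add, hy, hz, map_add, mul_add, map_add]

/-- Convolving `â` on the left by `ω` gives the functional of `(ω S⁻¹ ⊗ id)(Δ a)`. -/
lemma conv_hat (ω : A →ₗ[ℂ] ℂ) (a : A) :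
    conv G.Δ ω (G.hat a) = G.hat (lslice (ω ∘ₗ G.Sinv) (G.Δ a)) := by
  ext x
  rw [hat_apply, ← map_rslice_one_tmul_mul, G.φ_strong, LinearMap.comp_apply, G.S_leftinv,
    ← pair_hat]
  rfl

lemma counit_lslice (η : A →ₗ[ℂ] ℂ) (a : A) : G.ε (lslice η (G.Δ a)) = η a := by
  have h (t : A ⊗[ℂ] A) : G.ε (lslice η t) = η (rslice G.ε.toLinearMap t) := by
    induction t with
    | zero => simp
    | tmul x y => simp [rslice, lslice, mul_comm]
    | add x y hx hy => simp only [map_add, hx, hy]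
  rw [h, G.counit_right]

lemma Sinv_eq (a : A) : G.Sinv a = star (G.S (star a)) := by
  conv_lhs => rw [← G.S_star_S a]
  exact G.S_leftinv _

lemma conjdual_inv' (ω : A →ₗ[ℂ] ℂ) : conjdual (G.inv' ω) = ω ∘ₗ G.Sinv := by
  ext x
  rw [LinearMap.comp_apply, Sinv_eq]
  exact Complex.conj_conj _

end AQG

lemma pair_eq_lslice {A : Type*} [AddCommGroup A] [Module ℂ A] (ω η : A →ₗ[ℂ] ℂ)
    (t : A ⊗[ℂ] A) : pair ω η t = η (lslice ω t) := by
  induction t with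
  | zero => simp
  | tmul x y => simp [pair, lslice]
  | add x y hx hy => simp only [map_add, hx, hy]

/-- Proposition 3.1(a), concrete form: if `ĉ (S(a*))^ = (S(a*))^` and
`d̂ = ĉ* b̂ â` then `ε(d) = φ(S⁻¹(a) b)`, i.e. `ψ̂(ĉ* b̂ â) = φ(S⁻¹(a)b)`. -/
theorem stmt12 {A : Type*} [Ring A] [Algebra ℂ A] [StarRing A] [StarModule ℂ A]
    (G : AQG A) :
    ∀ a b c d : A,
      conv G.Δ (G.hat c) (G.hat (G.S (star a))) = G.hat (G.S (star a)) →
      G.hat d = conv G.Δ (conv G.Δ (G.inv' (G.hat c)) (G.hat b)) (G.hat a) →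
      G.ε d = G.φ (G.Sinv a * b) := by
  intro a b c d hc hd
  rw [G.conv_hat] at hc hd
  have he := G.hat_injective hc
  rw [G.hat_injective hd, G.counit_lslice, LinearMap.comp_apply, G.Sinv_eq]
  change pair _ _ (G.Δ _) = _
  rw [G.Δ_star, G.conjdual_inv', pair_eq_lslice, he]
  exact Complex.conj_conj _
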